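/- Fix reals P_T > 0, N > 0, J_Max > 0, an integer N_T ≥ 1, and an integer m with 0 ≤ m ≤ N_T − 1. Define α_m by α_m⁻¹ = Σ_{i=0}^{m} (R_i)⁻¹ and set J_{Ave,m} = ((m+1) − α_m⁻¹·R_{m+1})·(J_Max/N_T). Then the value of the constrained zero-sum game with jammer average power J_{Ave,m} equals R_{m+1}: sup over mixed strategies x of (inf over y ∈ Y_LE(J_{Ave,m}) of xᵀ C y) = inf over y ∈ Y_LE(J_{Ave,m}) of (sup over mixed strategies x of xᵀ C y) = R_{m+1} = (1/2)·log(1 + P_T/(N + ((m+1)/N_T)·J_Max)). -/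

import Mathlib

open BigOperators

/-- Rate `R_i = (1/2)·log(1 + P_T/(N + (i/N_T)·J_Max))`. -/
noncomputable def rate (P_T N J_Max : ℝ) (N_T i : ℕ) : ℝ :=
  (1 / 2) * Real.log (1 + P_T / (N + ((i : ℝ) / (N_T : ℝ)) * J_Max))

/-- Payoff matrix `C_{i,j} = R_i` if `j ≤ i`, else `0`. -/
noncomputable def payC (P_T N J_Max : ℝ) (N_T : ℕ) (i j : Fin (N_T + 1)) : ℝ :=
  if (j : ℕ) ≤ (i : ℕ) then rate P_T N J_Max N_T (i : ℕ) else 0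

/-- Jamming power level `J_j = (j/N_T)·J_Max`. -/
noncomputable def jamPow (J_Max : ℝ) (N_T j : ℕ) : ℝ := ((j : ℝ) / (N_T : ℝ)) * J_Max

/-- The simplex of mixed strategies. -/
def mixedSet (n : ℕ) : Set (Fin n → ℝ) := {x | (∀ i, 0 ≤ x i) ∧ ∑ i, x i = 1}

/-- Jammer's average-power constrained mixed strategy set `Y_LE(J_Ave)`. -/
noncomputable def YLE (J_Max : ℝ) (N_T : ℕ) (J_Ave : ℝ) : Set (Fin (N_T + 1) → ℝ) :=
  {y | y ∈ mixedSet (N_T + 1) ∧ ∑ j : Fin (N_T + 1), jamPow J_Max N_T (j : ℕ) * y j ≤ J_Ave}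

/-- Expected payoff `xᵀ C y`. -/
noncomputable def payoff (P_T N J_Max : ℝ) (N_T : ℕ) (x y : Fin (N_T + 1) → ℝ) : ℝ :=
  ∑ i, ∑ j, x i * payC P_T N J_Max N_T i j * y j

/-- `J_{Ave,m} = ((m+1) − α_m⁻¹·R_{m+1})·(J_Max/N_T)` where
`α_m⁻¹ = Σ_{i=0}^{m} R_i⁻¹`. -/
noncomputable def JAvem (P_T N J_Max : ℝ) (N_T m : ℕ) : ℝ :=
  (((m : ℝ) + 1) -
      (∑ i ∈ Finset.range (m + 1), (rate P_T N J_Max N_T i)⁻¹) * rate P_T N J_Max N_T (m + 1)) *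
    (J_Max / (N_T : ℝ))


lemma rate_pos' {P N J : ℝ} (hP : 0 < P) (hN : 0 < N) (hJ : 0 < J) (n i : ℕ) :
    0 < rate P N J n i := by
  unfold rate
  have h : 0 < N + ((i : ℝ) / (n : ℝ)) * J := by positivity
  have : 0 < P / (N + ((i : ℝ) / (n : ℝ)) * J) := by positivity
  have := Real.log_pos (show (1 : ℝ) < 1 + P / (N + ((i : ℝ) / (n : ℝ)) * J) by linarith)
  linarith

lemma rate_anti' {P N J : ℝ} (hP : 0 < P) (hN : 0 < N) (hJ : 0 < J) (n : ℕ) :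
    Antitone (rate P N J n) := by
  intro i k hik
  unfold rate
  have h : 0 < N + ((i : ℝ) / (n : ℝ)) * J := by positivity
  have h2 : 0 < N + ((k : ℝ) / (n : ℝ)) * J := by positivity
  have hc : (i : ℝ) ≤ k := by exact_mod_cast hik
  gcongr

lemma saddle_aux {A B : Type*} (f : A → B → ℝ) (V : ℝ) (x0 : A) (y0 : B)
    (h0 : ∀ x y, 0 ≤ f x y) (K : ℝ) (hK : ∀ x y, f x y ≤ K)
    (hx : ∀ y, V ≤ f x0 y) (hy : ∀ x, f x y0 ≤ V) :
    (⨆ x, ⨅ y, f x y) = V ∧ (⨅ y, ⨆ x, f x y) = V := by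
  have : Nonempty A := ⟨x0⟩
  have : Nonempty B := ⟨y0⟩
  have bl : ∀ x, (⨅ y, f x y) ≤ V := fun x =>
    (ciInf_le ⟨0, by rintro _ ⟨y, rfl⟩; exact h0 x y⟩ y0).trans (hy x)
  have bu : ∀ y, V ≤ ⨆ x, f x y := fun y =>
    (hx y).trans (le_ciSup (f := fun x => f x y) ⟨K, by rintro _ ⟨x, rfl⟩; exact hK x y⟩ x0)
  refine ⟨le_antisymm (ciSup_le bl) ?_, le_antisymm ?_ (le_ciInf bu)⟩
  · exact (le_ciInf hx).trans
      (le_ciSup (f := fun x => ⨅ y, f x y) ⟨V, by rintro _ ⟨x, rfl⟩; exact bl x⟩ x0)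
  · exact (ciInf_le (f := fun y => ⨆ x, f x y) ⟨V, by rintro _ ⟨x, rfl⟩; exact bu x⟩ y0).trans
      (ciSup_le hy)

/-- increments of a sequence -/
def incr (G : ℕ → ℝ) : ℕ → ℝ
  | 0 => G 0
  | (j + 1) => G (j + 1) - G j

lemma incr_sum (G : ℕ → ℝ) (k : ℕ) : ∑ j ∈ Finset.range (k + 1), incr G j = G k := by
  induction k with
  | zero => simp [incr]
  | succ k ih => rw [Finset.sum_range_succ, ih]; simp [incr]

lemma incr_power (G : ℕ → ℝ) (k : ℕ) :
    ∑ j ∈ Finset.range (k + 1), (j : ℝ) * incr G j = k * G k - ∑ i ∈ Finset.range k, G i := by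
  induction k with
  | zero => simp [incr]
  | succ k ih => rw [Finset.sum_range_succ, ih, Finset.sum_range_succ]; simp only [incr]; push_cast; ring

lemma incr_cum (G : ℕ → ℝ) (n i : ℕ) (h : i ≤ n) :
    ∑ j ∈ Finset.range (n + 1), (if j ≤ i then incr G j else 0) = G i := by
  rw [← incr_sum G i, ← Finset.sum_filter]
  congr 1
  ext j
  simp only [Finset.mem_filter, Finset.mem_range]
  omega

lemma count_aux (j M : ℕ) :
    (M : ℝ) - j ≤ ∑ i ∈ Finset.range M, (if j ≤ i then (1 : ℝ) else 0) := by
  induction M with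
  | zero => simp
  | succ M ih =>
    rw [Finset.sum_range_succ]
    split_ifs with h
    · push_cast; linarith
    · have h1 : (M : ℝ) + 1 ≤ j := by exact_mod_cast (by omega : M + 1 ≤ j)
      have : 0 ≤ ∑ i ∈ Finset.range M, (if j ≤ i then (1 : ℝ) else 0) :=
        Finset.sum_nonneg fun i _ => by split_ifs <;> norm_num
      push_cast; linarith

theorem game_value_weak_jammer
    (P_T N J_Max : ℝ) (hP : 0 < P_T) (hN : 0 < N) (hJ : 0 < J_Max)
    (N_T : ℕ) (hNT : 1 ≤ N_T) (m : ℕ) (hm : m ≤ N_T - 1) :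
    (⨆ x : mixedSet (N_T + 1), ⨅ y : YLE J_Max N_T (JAvem P_T N J_Max N_T m),
        payoff P_T N J_Max N_T (x : Fin (N_T + 1) → ℝ) (y : Fin (N_T + 1) → ℝ)) =
      rate P_T N J_Max N_T (m + 1) ∧
    (⨅ y : YLE J_Max N_T (JAvem P_T N J_Max N_T m), ⨆ x : mixedSet (N_T + 1),
        payoff P_T N J_Max N_T (x : Fin (N_T + 1) → ℝ) (y : Fin (N_T + 1) → ℝ)) =
      rate P_T N J_Max N_T (m + 1) ∧
    rate P_T N J_Max N_T (m + 1) =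
      (1 / 2) * Real.log (1 + P_T / (N + (((m : ℝ) + 1) / (N_T : ℝ)) * J_Max)) := by
  have hRp := rate_pos' hP hN hJ N_T
  have hRa := rate_anti' hP hN hJ N_T
  have hn0 : (0 : ℝ) < N_T := by exact_mod_cast hNT
  have hmn : m + 1 ≤ N_T := by omega
  have hthird : rate P_T N J_Max N_T (m + 1) =
      (1 / 2) * Real.log (1 + P_T / (N + (((m : ℝ) + 1) / (N_T : ℝ)) * J_Max)) := by
    unfold rate; push_cast; rfl
  have hpc : ∀ i j, 0 ≤ payC P_T N J_Max N_T i j := by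
    intro i j; unfold payC; split_ifs
    · exact (hRp _).le
    · exact le_rfl
  have hle1 : ∀ x ∈ mixedSet (N_T + 1), ∀ i, x i ≤ 1 := by
    intro x hx i
    rw [← hx.2]
    exact Finset.single_le_sum (fun i _ => hx.1 i) (Finset.mem_univ i)
  set R := rate P_T N J_Max N_T with hR
  set S := ∑ i ∈ Finset.range (m + 1), (R i)⁻¹ with hS
  have hSp : 0 < S := Finset.sum_pos (fun i _ => inv_pos.mpr (hRp i)) ⟨0, by simp⟩
  clear_value S
  clear_value R
  -- the transmitter strategy
  let xf : ℕ → ℝ := fun i => if i < m + 1 then S⁻¹ * (R i)⁻¹ else 0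
  have hsumx : ∀ f : ℕ → ℝ, ∑ i ∈ Finset.range (N_T + 1), xf i * f i
      = ∑ i ∈ Finset.range (m + 1), S⁻¹ * (R i)⁻¹ * f i := by
    intro f
    rw [← Finset.sum_subset (s₁ := Finset.range (m + 1))]
    · refine Finset.sum_congr rfl fun i hi => ?_
      simp only [xf, if_pos (Finset.mem_range.mp hi)]
    · intro i hi; simp only [Finset.mem_range] at *; omega
    · intro i _ hi
      simp only [Finset.mem_range] at hi
      simp only [xf, if_neg hi, zero_mul]
  have hxmem : (fun i : Fin (N_T + 1) => xf i) ∈ mixedSet (N_T + 1) := by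
    refine ⟨fun i => ?_, ?_⟩
    · simp only [xf]; split_ifs
      · exact mul_nonneg (inv_pos.mpr hSp).le (inv_pos.mpr (hRp i)).le
      · exact le_rfl
    · rw [Fin.sum_univ_eq_sum_range (fun i => xf i)]
      have := hsumx (fun _ => 1)
      simp only [mul_one] at this
      rw [this, ← Finset.mul_sum, ← hS]
      exact inv_mul_cancel₀ hSp.ne'
  -- the jammer strategy
  let G : ℕ → ℝ := fun i => R (m + 1) / R (min i (m + 1))
  have hGm : Monotone G := by
    intro a b hab
    have h1 := hRp (min b (m + 1))
    have h2 := (hRp (m + 1)).le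
    have h3 : R (min b (m + 1)) ≤ R (min a (m + 1)) := hRa (by omega)
    exact div_le_div_of_nonneg_left h2 h1 h3
  have hG0 : ∀ i, 0 ≤ G i := fun i => (div_pos (hRp _) (hRp _)).le
  have hG1 : ∀ i, m + 1 ≤ i → G i = 1 := by
    intro i hi
    simp only [G, min_eq_right hi]
    exact div_self (hRp _).ne'
  have hinc0 : ∀ j, 0 ≤ incr G j := by
    intro j
    cases j with
    | zero => exact hG0 0
    | succ j => exact sub_nonneg.mpr (hGm (Nat.le_succ j))
  have hRG : ∀ i, R i * G i ≤ R (m + 1) := by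
    intro i
    have h1 := hRp (min i (m + 1))
    have h2 := hRp (m + 1)
    have h3 : R i ≤ R (min i (m + 1)) := hRa (by omega)
    simp only [G]
    rw [← mul_div_assoc, div_le_iff₀ h1]
    nlinarith
  have hsumG : ∀ k, ∑ i ∈ Finset.range (m + 1 + k), G i = S * R (m + 1) + k := by
    intro k
    induction k with
    | zero =>
      rw [hS, Finset.sum_mul]
      simp only [add_zero, Nat.cast_zero]
      refine Finset.sum_congr rfl fun i hi => ?_
      have := Finset.mem_range.mp hi
      simp only [G, min_eq_left this.le]
      rw [div_eq_inv_mul]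
    | succ k ih =>
      rw [← add_assoc, Finset.sum_range_succ, ih, hG1 _ (by omega)]
      push_cast; ring
  have hymem : (fun j : Fin (N_T + 1) => incr G j) ∈ YLE J_Max N_T (JAvem P_T N J_Max N_T m) := by
    refine ⟨⟨fun j => hinc0 j, ?_⟩, ?_⟩
    · rw [Fin.sum_univ_eq_sum_range (fun i => incr G i), incr_sum, hG1 _ hmn]
    · rw [Fin.sum_univ_eq_sum_range (fun i => jamPow J_Max N_T i * incr G i)]
      have e : ∀ j, jamPow J_Max N_T j * incr G j = (J_Max / N_T) * ((j : ℝ) * incr G j) := by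
        intro j; unfold jamPow; ring
      simp only [e]
      rw [← Finset.mul_sum, incr_power, hG1 _ hmn]
      obtain ⟨k, hk⟩ := Nat.exists_eq_add_of_le hmn
      have h2 : ∑ i ∈ Finset.range N_T, G i = S * R (m + 1) + k := by
        rw [← hsumG k, ← hk]
      have h3 : (N_T : ℝ) = m + 1 + k := by exact_mod_cast hk
      rw [h2]
      unfold JAvem
      rw [← hR, ← hS]
      apply le_of_eq
      rw [mul_comm (J_Max / (N_T : ℝ))]
      congr 1
      linarith
  have key := saddle_aux
    (fun (x : mixedSet (N_T + 1)) (y : YLE J_Max N_T (JAvem P_T N J_Max N_T m)) =>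
      payoff P_T N J_Max N_T (x : Fin (N_T + 1) → ℝ) (y : Fin (N_T + 1) → ℝ))
    (R (m + 1)) ⟨_, hxmem⟩ ⟨_, hymem⟩ ?_ (∑ i, ∑ j, payC P_T N J_Max N_T i j) ?_ ?_ ?_
  · exact ⟨key.1, key.2, hthird⟩
  · rintro ⟨x, hx⟩ ⟨y, hy⟩
    exact Finset.sum_nonneg fun i _ => Finset.sum_nonneg fun j _ =>
      mul_nonneg (mul_nonneg (hx.1 i) (hpc i j)) (hy.1.1 j)
  · rintro ⟨x, hx⟩ ⟨y, hy⟩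
    refine Finset.sum_le_sum fun i _ => Finset.sum_le_sum fun j _ => ?_
    have a1 : x i * payC P_T N J_Max N_T i j ≤ payC P_T N J_Max N_T i j :=
      mul_le_of_le_one_left (hpc i j) (hle1 x hx i)
    exact (mul_le_of_le_one_right (mul_nonneg (hx.1 i) (hpc i j)) (hle1 y hy.1 j)).trans a1
  · rintro ⟨y, hy⟩
    simp only [payoff]
    rw [Finset.sum_comm]
    have hcol : ∀ j : Fin (N_T + 1), S⁻¹ * ((m + 1 : ℝ) - (j : ℕ)) * y j ≤
        ∑ i : Fin (N_T + 1), xf i * payC P_T N J_Max N_T i j * y j := by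
      intro j
      rw [← Finset.sum_mul]
      refine mul_le_mul_of_nonneg_right ?_ (hy.1.1 j)
      have e1 : ∑ i : Fin (N_T + 1), xf i * payC P_T N J_Max N_T i j
          = ∑ i ∈ Finset.range (N_T + 1), xf i * (if (j : ℕ) ≤ i then R i else 0) := by
        rw [← Fin.sum_univ_eq_sum_range (fun i => xf i * (if (j : ℕ) ≤ i then R i else 0))]
        simp only [payC, hR]
      rw [e1, hsumx]
      have e2 : ∑ i ∈ Finset.range (m + 1), S⁻¹ * (R i)⁻¹ * (if (j : ℕ) ≤ i then R i else 0)
          = S⁻¹ * ∑ i ∈ Finset.range (m + 1), (if (j : ℕ) ≤ i then (1 : ℝ) else 0) := by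
        rw [Finset.mul_sum]
        refine Finset.sum_congr rfl fun i _ => ?_
        split_ifs
        · rw [mul_assoc, inv_mul_cancel₀ (hRp i).ne']
        · simp
      rw [e2]
      have := count_aux (j : ℕ) (m + 1)
      push_cast at this
      exact mul_le_mul_of_nonneg_left this (inv_pos.mpr hSp).le
    refine le_trans ?_ (Finset.sum_le_sum fun j _ => hcol j)
    have hpow := hy.2
    have e3 : ∑ j : Fin (N_T + 1), jamPow J_Max N_T (j : ℕ) * y j
        = (∑ j : Fin (N_T + 1), ((j : ℕ) : ℝ) * y j) * (J_Max / N_T) := by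
      rw [Finset.sum_mul]
      refine Finset.sum_congr rfl fun j _ => ?_
      unfold jamPow; ring
    rw [e3] at hpow
    unfold JAvem at hpow
    rw [← hR, ← hS] at hpow
    have hp2 := le_of_mul_le_mul_right hpow (div_pos hJ hn0)
    have e4 : ∑ j : Fin (N_T + 1), S⁻¹ * ((m + 1 : ℝ) - (j : ℕ)) * y j
        = S⁻¹ * ((m + 1 : ℝ) - ∑ j : Fin (N_T + 1), ((j : ℕ) : ℝ) * y j) := by
      have : (m + 1 : ℝ) = ∑ j : Fin (N_T + 1), (m + 1 : ℝ) * y j := by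
        rw [← Finset.mul_sum, hy.1.2, mul_one]
      conv_rhs => rw [this]
      rw [← Finset.sum_sub_distrib, Finset.mul_sum]
      refine Finset.sum_congr rfl fun j _ => ?_
      ring
    rw [e4, ← div_eq_inv_mul, le_div_iff₀ hSp]
    linarith
  · rintro ⟨x, hx⟩
    simp only [payoff]
    have hrow : ∀ i : Fin (N_T + 1),
        ∑ j : Fin (N_T + 1), x i * payC P_T N J_Max N_T i j * incr G j ≤ x i * R (m + 1) := by
      intro i
      have e1 : ∑ j : Fin (N_T + 1), x i * payC P_T N J_Max N_T i j * incr G j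
          = x i * (R i * G i) := by
        rw [← incr_cum G N_T i (by omega), ← Fin.sum_univ_eq_sum_range
          (fun j => if j ≤ (i : ℕ) then incr G j else 0), Finset.mul_sum, Finset.mul_sum]
        refine Finset.sum_congr rfl fun j _ => ?_
        unfold payC
        rw [← hR]
        split_ifs <;> ring
      rw [e1]
      exact mul_le_mul_of_nonneg_left (hRG i) (hx.1 i)
    refine (Finset.sum_le_sum fun i _ => hrow i).trans ?_
    rw [← Finset.sum_mul, hx.2, one_mul]
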